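/- Let G, H be primitive graphs and P : E_G × E_H → ℤ a payoff function. Then X_H† is a sofic shift over the alphabet E_H, and Y†_{(H,G)} is a sofic shift over the alphabet E_H × E_G. -/

import Mathlib

open Filter Set

structure DirGraph (V E : Type) where
  src : E → V
  tgt : E → V

namespace DirGraph

variable {V E : Type}

/-- A (finite) walk: consecutive edges are compatible. -/
def IsWalkList (G : DirGraph V E) (p : List E) : Prop :=
  p.Chain' fun e f => G.tgt e = G.src f

/-- The set of walks of length `n`. -/
def walks (G : DirGraph V E) (n : ℕ) : Set (List E) :=
  {p | p.length = n ∧ G.IsWalkList p}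

/-- The set of walks of length `n` from `v` to `w`. -/
def walksFT (G : DirGraph V E) (n : ℕ) (v w : V) : Set (List E) :=
  {p | p.length = n ∧ G.IsWalkList p ∧
    ∃ h : p ≠ [], G.src (p.head h) = v ∧ G.tgt (p.getLast h) = w}

def IsCycle (G : DirGraph V E) (p : List E) : Prop :=
  G.IsWalkList p ∧ ∃ h : p ≠ [], G.src (p.head h) = G.tgt (p.getLast h)

def Irreducible (G : DirGraph V E) : Prop :=
  ∀ v w : V, ∃ n : ℕ, (G.walksFT n v w).Nonempty

/-- Irreducible and the gcd of all cycle lengths is 1 (every common divisor of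
the cycle lengths equals 1). -/
def Primitive (G : DirGraph V E) : Prop :=
  G.Irreducible ∧ ∀ d : ℕ, (∀ p, G.IsCycle p → d ∣ p.length) → d = 1

end DirGraph

/-- `Σ_i P(q_i, p_i)`. -/
def payoffSum {EG EH : Type} (P : EG → EH → ℤ) (q : List EG) (p : List EH) : ℤ :=
  (List.zipWith P q p).sum

/-- `V_n(G,H,P) = max_{p ∈ W_n(H)} min_{q ∈ W_n(G)} Σ P(q_i,p_i)`. -/
noncomputable def Vn {VG EG VH EH : Type} (G : DirGraph VG EG) (H : DirGraph VH EH)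
    (P : EG → EH → ℤ) (n : ℕ) : ℤ :=
  sSup ((fun p => sInf ((fun q => payoffSum P q p) '' G.walks n)) '' H.walks n)

/-- `M(p)(v,w) = inf {Σ P(q_i,p_i) : q ∈ W_n(G, v → w)}`, with `inf ∅ = ⊤`. -/
noncomputable def Mfun {VG EG EH : Type} (G : DirGraph VG EG) (P : EG → EH → ℤ)
    (p : List EH) : VG → VG → WithTop ℤ :=
  fun v w => sInf ((fun q => ((payoffSum P q p : ℤ) : WithTop ℤ)) '' G.walksFT p.length v w)

/-- `f < g` pointwise everywhere. -/
def StrictDom {V α : Type} [LT α] (f g : V → V → α) : Prop := ∀ v w, f v w < g v w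

/-- `<`-maximal elements of a set w.r.t. a strict domination relation. -/
def maxElems {α : Type} (lt : α → α → Prop) (A : Set α) : Set α :=
  {f ∈ A | ¬ ∃ g ∈ A, lt f g}

/-- Tropical convolution on `(ℤ ∪ {∞})`-valued matrices. -/
noncomputable def tconv {V : Type} (f g : V → V → WithTop ℤ) : V → V → WithTop ℤ :=
  fun u w => sInf (Set.range fun v => f u v + g v w)

/-- Tropical convolution on `ℤ`-valued matrices. -/
noncomputable def tconvZ {V : Type} (f g : V → V → ℤ) : V → V → ℤ :=
  fun u w => sInf (Set.range fun v => f u v + g v w)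

/-- Non-improvable walks in `H` (of any length). -/
noncomputable def walksDagger {VG EG VH EH : Type} (G : DirGraph VG EG) (H : DirGraph VH EH)
    (P : EG → EH → ℤ) : Set (List EH) :=
  {p | ∃ u v : VH, p ∈ H.walksFT p.length u v ∧
    Mfun G P p ∈ maxElems StrictDom (Mfun G P '' H.walksFT p.length u v)}

/-- The edge shift of a graph. -/
def XEdge {V E : Type} (G : DirGraph V E) : Set (ℤ → E) :=
  {x | ∀ n : ℤ, G.tgt (x n) = G.src (x (n + 1))}

/-- The word `x_{[m,n]}` as a list (of length `n - m + 1` when `m ≤ n`). -/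
def seg {A : Type} (x : ℤ → A) (m n : ℤ) : List A :=
  List.ofFn fun i : Fin (n + 1 - m).toNat => x (m + i)

/-- `X_H^†`: points all of whose subwords are non-improvable walks. -/
noncomputable def XHdag {VG EG VH EH : Type} (G : DirGraph VG EG) (H : DirGraph VH EH)
    (P : EG → EH → ℤ) : Set (ℤ → EH) :=
  {x | x ∈ XEdge H ∧ ∀ m n : ℤ, m ≤ n → seg x m n ∈ walksDagger G H P}

/-- `R(p)`: optimal responses to `p`. -/
noncomputable def Rset {VG EG EH : Type} (G : DirGraph VG EG) (P : EG → EH → ℤ)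
    (p : List EH) : Set (List EG) :=
  {q | ∃ v w : VG, q ∈ G.walksFT p.length v w ∧
    ((payoffSum P q p : ℤ) : WithTop ℤ) = Mfun G P p v w}

/-- `X_𝒢`: the shift presented by the labeled graph `(G, L)`. -/
def XGset {V E A : Type} (G : DirGraph V E) (L : E → A) : Set (ℤ → A) :=
  {x | ∀ m n : ℤ, m ≤ n → ∃ p ∈ G.walks (n + 1 - m).toNat, p.map L = seg x m n}

/-- A sofic shift: one presented by a (finite) labeled graph. -/
def IsSofic {A : Type} (S : Set (ℤ → A)) : Prop :=
  ∃ (k l : ℕ) (G : DirGraph (Fin k) (Fin l)) (L : Fin l → A), S = XGset G L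

/-- `Y†_{(H,G)}` as a shift space over the alphabet `E_H × E_G`. -/
noncomputable def YdagSeq {VG EG VH EH : Type} (G : DirGraph VG EG)
    (H : DirGraph VH EH) (P : EG → EH → ℤ) : Set (ℤ → EH × EG) :=
  {z | (fun i => (z i).1) ∈ XHdag G H P ∧ (fun i => (z i).2) ∈ XEdge G ∧
    ∀ m n : ℤ, m ≤ n →
      seg (fun i => (z i).2) m n ∈ Rset G P (seg (fun i => (z i).1) m n)}

namespace DirGraph

/-- `l` is a walk from `v` to `w`; the empty walk joins each vertex to itself. -/
def IsPath {V E : Type} (G : DirGraph V E) : V → V → List E → Prop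
  | v, w, [] => v = w
  | v, w, e :: l => G.src e = v ∧ G.IsPath (G.tgt e) w l

theorem isPath_append {V E : Type} {G : DirGraph V E} {v w : V} {a b : List E} :
    G.IsPath v w (a ++ b) ↔ ∃ z, G.IsPath v z a ∧ G.IsPath z w b := by
  induction a generalizing v with
  | nil => simp [IsPath]
  | cons e a ih => simp [IsPath, ih, and_assoc]

theorem isWalkList_iff {V E : Type} {G : DirGraph V E} {l : List E} :
    G.IsWalkList l ↔ l.IsChain fun e f => G.tgt e = G.src f := Iff.rfl

theorem isPath_iff {V E : Type} {G : DirGraph V E} {v w : V} {l : List E} (hl : l ≠ []) :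
    G.IsPath v w l ↔
      G.IsWalkList l ∧ ∃ h : l ≠ [], G.src (l.head h) = v ∧ G.tgt (l.getLast h) = w := by
  induction l generalizing v with
  | nil => exact absurd rfl hl
  | cons e l ih =>
    cases l with
    | nil => simp [IsPath, isWalkList_iff]
    | cons f l =>
      have := @ih (G.tgt e) (by simp)
      rw [IsPath, this]
      simp only [isWalkList_iff, List.isChain_cons_cons]
      simp
      grind

theorem mem_walksFT {V E : Type} {G : DirGraph V E} {v w : V} {n : ℕ} {l : List E}
    (hl : l ≠ []) : l ∈ G.walksFT n v w ↔ l.length = n ∧ G.IsPath v w l := by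
  rw [isPath_iff hl]; rfl

theorem ne_nil_of_mem_walksFT {V E : Type} {G : DirGraph V E} {v w : V} {n : ℕ} {l : List E}
    (hl : l ∈ G.walksFT n v w) : l ≠ [] := hl.2.2.1

theorem isPath_of_mem_walksFT {V E : Type} {G : DirGraph V E} {v w : V} {n : ℕ} {l : List E}
    (hl : l ∈ G.walksFT n v w) : G.IsPath v w l :=
  ((mem_walksFT (ne_nil_of_mem_walksFT hl)).1 hl).2

theorem IsPath.source_target_eq {V E : Type} {G : DirGraph V E} {v w v' w' : V} {l : List E}
    (hl : l ≠ []) (h : G.IsPath v w l) (h' : G.IsPath v' w' l) : v = v' ∧ w = w' := by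
  rw [isPath_iff hl] at h h'
  obtain ⟨-, _, rfl, rfl⟩ := h
  obtain ⟨-, _, rfl, rfl⟩ := h'
  exact ⟨rfl, rfl⟩

theorem Primitive.nonempty {V E : Type} {G : DirGraph V E} (hG : G.Primitive) : Nonempty V := by
  by_contra h
  have := hG.2 0 fun p ⟨_, hp, _⟩ => (h ⟨G.src (p.head hp)⟩).elim
  omega

/-- In a primitive graph, any two vertices are joined by walks of every large length. -/
theorem Primitive.exists_bound {V E : Type} [Finite V] {G : DirGraph V E} (hG : G.Primitive) :
    ∃ N : ℕ, ∀ n, N ≤ n → ∀ v w : V, ∃ l : List E, l.length = n ∧ G.IsPath v w l := by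
  have hirr : ∀ v w : V, ∃ l : List E, G.IsPath v w l := fun v w => by
    obtain ⟨n, l, hl⟩ := hG.1 v w
    exact ⟨l, isPath_of_mem_walksFT hl⟩
  choose c hc using hirr
  obtain ⟨z⟩ := hG.nonempty
  let S : AddSubmonoid ℕ :=
    { carrier := {n | ∃ l : List E, l.length = n ∧ G.IsPath z z l}
      zero_mem' := ⟨[], rfl, rfl⟩
      add_mem' := by
        rintro _ _ ⟨l, rfl, hl⟩ ⟨m, rfl, hm⟩
        exact ⟨l ++ m, by simp, isPath_append.2 ⟨z, hl, hm⟩⟩ }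
  have hgcd : Nat.setGcd (S : Set ℕ) = 1 := by
    refine hG.2 _ fun p ⟨hp, hne, heq⟩ => ?_
    set w := G.src (p.head hne) with hw
    have hp' : G.IsPath w w p := (isPath_iff hne).2 ⟨hp, hne, rfl, heq.symm⟩
    have h1 : (c z w ++ c w z).length ∈ (S : Set ℕ) :=
      ⟨_, rfl, isPath_append.2 ⟨w, hc _ _, hc _ _⟩⟩
    have h2 : (c z w ++ (p ++ c w z)).length ∈ (S : Set ℕ) :=
      ⟨_, rfl, isPath_append.2 ⟨w, hc _ _, isPath_append.2 ⟨w, hp', hc _ _⟩⟩⟩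
    have h3 : (c z w ++ (p ++ c w z)).length = (c z w ++ c w z).length + p.length := by
      simp; omega
    rw [h3] at h2
    exact (Nat.dvd_add_right (Nat.setGcd_dvd_of_mem h1)).1 (Nat.setGcd_dvd_of_mem h2)
  obtain ⟨N, hN⟩ := Nat.exists_mem_closure_of_ge (S : Set ℕ)
  rw [hgcd, AddSubmonoid.closure_eq] at hN
  obtain ⟨A, hA⟩ := (Set.finite_range fun v => (c v z).length).bddAbove
  obtain ⟨B, hB⟩ := (Set.finite_range fun v => (c z v).length).bddAbove
  refine ⟨N + A + B, fun n hn v w => ?_⟩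
  have hA' : (c v z).length ≤ A := hA ⟨v, rfl⟩
  have hB' : (c z w).length ≤ B := hB ⟨w, rfl⟩
  obtain ⟨l, hl, hl'⟩ := hN (n - (c v z).length - (c z w).length) (by omega) (one_dvd _)
  refine ⟨c v z ++ (l ++ c z w), ?_, isPath_append.2 ⟨z, hc _ _, isPath_append.2 ⟨z, hl', hc _ _⟩⟩⟩
  simp only [List.length_append]
  omega

end DirGraph

/-- `l` and `l'` have equal length and agree outside a prefix and a suffix of length `≤ K`. -/
def AgreeOffEnds {A : Type} (K : ℕ) (l l' : List A) : Prop :=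
  ∃ a a' m b b', l = a ++ (m ++ b) ∧ l' = a' ++ (m ++ b') ∧ a'.length = a.length ∧
    b'.length = b.length ∧ a.length ≤ K ∧ b.length ≤ K

theorem AgreeOffEnds.length_eq {A : Type} {K : ℕ} {l l' : List A} (h : AgreeOffEnds K l l') :
    l'.length = l.length := by
  obtain ⟨a, a', m, b, b', rfl, rfl, ha, hb, -, -⟩ := h
  simp [ha, hb]

theorem AgreeOffEnds.symm {A : Type} {K : ℕ} {l l' : List A} (h : AgreeOffEnds K l l') :
    AgreeOffEnds K l' l := by
  obtain ⟨a, a', m, b, b', hl, hl', ha, hb, haK, hbK⟩ := h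
  exact ⟨a', a, m, b', b, hl', hl, ha.symm, hb.symm, ha ▸ haK, hb ▸ hbK⟩

/-- The endpoints of a walk can be changed at bounded cost, when its length permits it. -/
theorem DirGraph.Primitive.exists_agreeOffEnds {V E : Type} [Finite V] {G : DirGraph V E}
    (hG : G.Primitive) :
    ∃ K : ℕ, ∀ (v w v' w' : V) (l l₀ : List E), G.IsPath v' w' l → G.IsPath v w l₀ →
      l₀.length = l.length → ∃ l', G.IsPath v w l' ∧ AgreeOffEnds K l l' := by
  obtain ⟨N, hN⟩ := hG.exists_bound
  refine ⟨2 * N, fun v w v' w' l l₀ hl hl₀ hlen => ?_⟩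
  rcases le_total l.length (2 * N) with h | h
  · exact ⟨l₀, hl₀, l, l₀, [], [], [], by simp, by simp, hlen, rfl, h, by simp⟩
  · obtain ⟨a, r, rfl, ha⟩ : ∃ a r, l = a ++ r ∧ a.length = N :=
      ⟨l.take N, l.drop N, by simp, by simp; omega⟩
    rw [List.length_append] at h
    obtain ⟨m, b, rfl, hb⟩ : ∃ m b, r = m ++ b ∧ b.length = N :=
      ⟨r.take (r.length - N), r.drop (r.length - N), by simp, by simp; omega⟩
    obtain ⟨x, hx, hx'⟩ := isPath_append.1 hl
    obtain ⟨y, hy, hy'⟩ := isPath_append.1 hx'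
    obtain ⟨a', ha', hpa⟩ := hN N le_rfl v x
    obtain ⟨b', hb', hpb⟩ := hN N le_rfl y w
    exact ⟨a' ++ (m ++ b'), isPath_append.2 ⟨x, hpa, isPath_append.2 ⟨y, hy, hpb⟩⟩,
      a, a', m, b, b', rfl, rfl, by omega, by omega, by omega, by omega⟩

theorem payoffSum_append {EG EH : Type} {P : EG → EH → ℤ} {q q' : List EG} {p p' : List EH}
    (h : q.length = p.length) :
    payoffSum P (q ++ q') (p ++ p') = payoffSum P q p + payoffSum P q' p' := by
  simp [payoffSum, List.zipWith_append h]

theorem payoffSum_flip {EG EH : Type} (P : EG → EH → ℤ) (q : List EG) (p : List EH) :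
    payoffSum (fun b a => P a b) p q = payoffSum P q p := by
  rw [payoffSum, payoffSum, List.zipWith_comm]

theorem abs_payoffSum_le {EG EH : Type} {P : EG → EH → ℤ} {B : ℤ} (hB : ∀ e f, |P e f| ≤ B)
    (q : List EG) (p : List EH) (h : q.length = p.length) :
    |payoffSum P q p| ≤ p.length * B := by
  induction q generalizing p with
  | nil => cases p <;> simp_all [payoffSum]
  | cons e q ih =>
    cases p with
    | nil => simp at h
    | cons f p =>
      have h1 := ih p (by simpa using h)
      have h2 : payoffSum P (e :: q) (f :: p) = P e f + payoffSum P q p := by simp [payoffSum]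
      rw [h2, List.length_cons]
      push_cast
      linarith [abs_add_le (P e f) (payoffSum P q p), hB e f]

theorem AgreeOffEnds.payoffSum_le {EG EH : Type} {P : EG → EH → ℤ} {B : ℤ} (hB₀ : 0 ≤ B)
    (hB : ∀ e f, |P e f| ≤ B) {K : ℕ} {q q' : List EG} (h : AgreeOffEnds K q q') (p : List EH)
    (hp : p.length = q.length) : payoffSum P q' p ≤ payoffSum P q p + 4 * (K * B) := by
  obtain ⟨a, a', m, b, b', rfl, rfl, ha, hb, haK, hbK⟩ := h
  simp only [List.length_append] at hp
  obtain ⟨x, r, rfl, hx⟩ : ∃ x r, p = x ++ r ∧ x.length = a.length :=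
    ⟨p.take a.length, p.drop a.length, by simp, by simp; omega⟩
  rw [List.length_append] at hp
  obtain ⟨y, z, rfl, hy⟩ : ∃ y z, r = y ++ z ∧ y.length = m.length :=
    ⟨r.take m.length, r.drop m.length, by simp, by simp; omega⟩
  rw [List.length_append] at hp
  rw [payoffSum_append (by omega), payoffSum_append (by omega), payoffSum_append (by omega),
    payoffSum_append (by omega)]
  have h1 := abs_le.1 (abs_payoffSum_le hB a x (by omega))
  have h2 := abs_le.1 (abs_payoffSum_le hB a' x (by omega))
  have h3 := abs_le.1 (abs_payoffSum_le hB b z (by omega))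
  have h4 := abs_le.1 (abs_payoffSum_le hB b' z (by omega))
  have h5 : (x.length : ℤ) * B ≤ K * B :=
    mul_le_mul_of_nonneg_right (by exact_mod_cast hx.le.trans haK) hB₀
  have h6 : (z.length : ℤ) * B ≤ K * B :=
    mul_le_mul_of_nonneg_right (by norm_cast; omega) hB₀
  linarith [h1.1, h2.2, h3.1, h4.2]

theorem XGset_isSofic {V E A : Type} [Finite V] [Finite E] (G : DirGraph V E) (L : E → A) :
    IsSofic (XGset G L) := by
  obtain ⟨k, ⟨f⟩⟩ := Finite.exists_equiv_fin V
  obtain ⟨l, ⟨g⟩⟩ := Finite.exists_equiv_fin E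
  refine ⟨k, l, ⟨fun e => f (G.src (g.symm e)), fun e => f (G.tgt (g.symm e))⟩,
    fun e => L (g.symm e), ?_⟩
  ext x
  refine forall_congr' fun m => forall_congr' fun n => imp_congr_right fun _ => ⟨?_, ?_⟩
  · rintro ⟨p, ⟨hp, hw⟩, hL⟩
    refine ⟨p.map g, ⟨by simpa using hp, ?_⟩, ?_⟩
    · simpa [DirGraph.isWalkList_iff, List.isChain_map] using hw
    · rw [← hL, List.map_map]
      exact List.map_congr_left fun e _ => by simp
  · rintro ⟨p, ⟨hp, hw⟩, hL⟩
    refine ⟨p.map g.symm, ⟨by simpa using hp, ?_⟩, ?_⟩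
    · simpa [DirGraph.isWalkList_iff, List.isChain_map] using hw
    · rw [← hL, List.map_map]
      rfl

theorem Set.Finite.image_of_image {α β γ : Type*} {s : Set α} {f : α → β} {g : α → γ}
    (hf : (f '' s).Finite) (h : ∀ a ∈ s, ∀ b ∈ s, f a = f b → g a = g b) : (g '' s).Finite := by
  have : ∀ b : f '' s, ∃ a ∈ s, f a = b := fun b => b.2
  choose r hr hfr using this
  have := hf.to_subtype
  refine (Set.finite_range fun b => g (r b)).subset ?_
  rintro _ ⟨a, ha, rfl⟩
  exact ⟨⟨f a, a, ha, rfl⟩, h _ (hr _) _ ha (hfr _)⟩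

theorem seg_ne_nil {A : Type} (x : ℤ → A) {m n : ℤ} (h : m ≤ n) : seg x m n ≠ [] := by
  intro h'
  have := congrArg List.length h'
  simp [seg] at this
  omega

theorem exists_seg_of_infix {A : Type} {x : ℤ → A} {m n : ℤ} {f : List A}
    (hf : f <:+: seg x m n) (hne : f ≠ []) : ∃ a b, a ≤ b ∧ f = seg x a b := by
  obtain ⟨k, hk, h⟩ := List.infix_iff_getElem?.1 hf
  have hpos := List.length_pos_iff.2 hne
  refine ⟨m + k, m + k + f.length - 1, by omega, ?_⟩
  have hlen : (seg x (m + k) (m + k + f.length - 1)).length = f.length := by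
    simp [seg]
  refine List.ext_getElem hlen.symm fun i h1 h2 => ?_
  have h3 := h i h1
  rw [List.getElem?_eq_some_iff] at h3
  obtain ⟨h4, h5⟩ := h3
  rw [← h5]
  simp only [seg, List.getElem_ofFn]
  congr 1
  push_cast
  ring

/-- A shift whose allowed words are determined, past a given prefix, by finitely many states. -/
theorem isSofic_of_finite_state {A σ : Type} [Finite A] (W : Set (List A)) (state : List A → σ)
    (hfin : (state '' W).Finite)
    (htrans : ∀ s ∈ W, ∀ s' ∈ W, ∀ t ∈ W, state s = state s' → s ++ t ∈ W → s' ++ t ∈ W) :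
    IsSofic {x : ℤ → A | ∀ m n : ℤ, m ≤ n → seg x m n ∈ W} := by
  set L : Set (List A) := {l | ∀ f, f <:+: l → f ≠ [] → f ∈ W} with hL
  have hmono : ∀ {l l' : List A}, l' <:+: l → l ∈ L → l' ∈ L :=
    fun h hl f hf hne => hl f (hf.trans h) hne
  set S : List A → Set σ := fun p => state '' {s | s <:+ p ∧ s ≠ []} with hS
  set F : List A → Set (List A) := fun p => {q | p ++ q ∈ L} with hF
  have hSfin : (S '' L).Finite := by
    refine hfin.finite_subsets.subset ?_
    rintro _ ⟨p, hp, rfl⟩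
    rintro _ ⟨s, ⟨hs, hne⟩, rfl⟩
    exact ⟨s, hp s hs.isInfix hne, rfl⟩
  have hle : ∀ p ∈ L, ∀ p' ∈ L, S p = S p' → F p ⊆ F p' := by
    intro p hp p' hp' hpp q hq f hf hne
    have hqL : q ∈ L := hmono List.infix_append_right hq
    rcases List.infix_append_iff.1 hf with h | h | ⟨l₁, l₂, rfl, h₁, h₂⟩
    · exact hp' f h hne
    · exact hqL f h hne
    · by_cases e₁ : l₁ = []
      · subst e₁
        exact hqL _ h₂.isInfix hne
      by_cases e₂ : l₂ = []
      · subst e₂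
        exact hp' _ (by simpa using h₁.isInfix) hne
      have : state l₁ ∈ S p := hpp ▸ ⟨l₁, ⟨h₁, e₁⟩, rfl⟩
      obtain ⟨s, ⟨hs, hsne⟩, hst⟩ := this
      refine htrans s (hp s hs.isInfix hsne) l₁ (hp' _ h₁.isInfix e₁) l₂
        (hqL _ h₂.isInfix e₂) hst (hq _ ?_ (by simp [hsne]))
      exact List.infix_append_iff.2 (.inr (.inr ⟨s, l₂, rfl, hs, h₂⟩))
  have hFfin : (F '' L).Finite := hSfin.image_of_image fun p hp p' hp' h =>
    (hle p hp p' hp' h).antisymm (hle p' hp' p hp h.symm)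
  have := hFfin.to_subtype
  have hstep : ∀ (U : F '' L) (a : A), [a] ∈ U.1 → {q | a :: q ∈ U.1} ∈ F '' L := by
    rintro ⟨_, p, hp, rfl⟩ a ha
    exact ⟨p ++ [a], ha, by ext q; simp [hF]⟩
  let Γ : DirGraph (F '' L) {e : (F '' L) × A // [e.2] ∈ e.1.1} :=
    ⟨fun e => e.1.1, fun e => ⟨_, hstep e.1.1 e.1.2 e.2⟩⟩
  have hpref : ∀ (U : F '' L) (q r : List A), q ++ r ∈ U.1 → q ∈ U.1 := by
    rintro ⟨_, p, hp, rfl⟩ q r h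
    refine hmono ?_ h
    rw [← List.append_assoc]
    exact List.infix_append_left
  have hwalk : ∀ (w : List A) (U : F '' L), w ∈ U.1 →
      ∃ p : List _, (∃ U', Γ.IsPath U U' p) ∧ p.map (fun e => e.1.2) = w := by
    intro w
    induction w with
    | nil => exact fun U _ => ⟨[], ⟨U, rfl⟩, rfl⟩
    | cons a w ih =>
      intro U hU
      have ha : [a] ∈ U.1 := hpref U [a] w hU
      obtain ⟨p, ⟨U', hp⟩, hw⟩ := ih ⟨_, hstep U a ha⟩ hU
      exact ⟨⟨(U, a), ha⟩ :: p, ⟨U', rfl, hp⟩, by simp [hw]⟩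
  have hwalk' : ∀ (p : List _) (U U' : F '' L), Γ.IsPath U U' p →
      p.map (fun e => e.1.2) ∈ U.1 := by
    intro p
    induction p with
    | nil =>
      rintro ⟨_, p, hp, rfl⟩ U' h
      simpa [hF] using hp
    | cons e p ih =>
      rintro U U' ⟨rfl, h⟩
      exact ih _ _ h
  convert XGset_isSofic Γ (fun e => e.1.2) using 1
  ext x
  refine ⟨fun hx m n hmn => ?_, fun hx m n hmn => ?_⟩
  · have h0 : ([] : List A) ∈ L := fun f hf hne => absurd (List.infix_nil.1 hf) hne
    have hseg : seg x m n ∈ L := fun f hf hne => by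
      obtain ⟨a, b, hab, rfl⟩ := exists_seg_of_infix hf hne
      exact hx a b hab
    obtain ⟨p, ⟨U', hp⟩, hw⟩ := hwalk (seg x m n) ⟨F [], [], h0, rfl⟩ hseg
    have hne : p ≠ [] := by
      rintro rfl
      exact seg_ne_nil x hmn hw.symm
    refine ⟨p, ⟨?_, ((DirGraph.isPath_iff hne).1 hp).1⟩, hw⟩
    rw [← List.length_map (as := p) (f := fun e => e.1.2), hw]
    simp [seg]
  · obtain ⟨p, ⟨-, hw⟩, hp⟩ := hx m n hmn
    have hne : p ≠ [] := by
      rintro rfl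
      exact seg_ne_nil x hmn hp.symm
    have h := hwalk' p _ _ ((DirGraph.isPath_iff hne).2 ⟨hw, hne, rfl, rfl⟩)
    rw [hp] at h
    obtain ⟨r, -, hr⟩ := (Γ.src (p.head hne)).2
    rw [← hr] at h
    exact h _ List.infix_append_right (seg_ne_nil x hmn)

theorem edge_of_seg {V E : Type} {G : DirGraph V E} {x : ℤ → E} {n : ℤ}
    (h : G.IsWalkList (seg x n (n + 1))) : G.tgt (x n) = G.src (x (n + 1)) := by
  have h2 : (n + 1 + 1 - n).toNat = 2 := by omega
  rw [DirGraph.isWalkList_iff, seg, List.ofFn_congr h2] at h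
  simpa using h

section Payoff

variable {VG EG EH : Type} {G : DirGraph VG EG} {P : EG → EH → ℤ}

theorem isGLB_Mfun [Finite EG] (p : List EH) (v w : VG) :
    IsGLB ((fun q => ((payoffSum P q p : ℤ) : WithTop ℤ)) '' G.walksFT p.length v w)
      (Mfun G P p v w) :=
  WithTop.isGLB_sInf' <| Set.Finite.bddBelow <| Set.Finite.image _ <|
    (List.finite_length_eq EG p.length).subset fun _ h => h.1

theorem Mfun_le [Finite EG] {p : List EH} (hp : p ≠ []) {q : List EG} {v w : VG}
    (hq : G.IsPath v w q) (hlen : q.length = p.length) :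
    Mfun G P p v w ≤ (payoffSum P q p : ℤ) := by
  have hne : q ≠ [] := List.ne_nil_of_length_pos (hlen ▸ List.length_pos_iff.2 hp)
  exact (isGLB_Mfun p v w).1 ⟨q, (DirGraph.mem_walksFT hne).2 ⟨hlen, hq⟩, rfl⟩

theorem exists_eq_Mfun [Finite EG] {p : List EH} {v w : VG} (h : Mfun G P p v w ≠ ⊤) :
    ∃ q, q.length = p.length ∧ G.IsPath v w q ∧ Mfun G P p v w = (payoffSum P q p : ℤ) := by
  have hne : (G.walksFT p.length v w).Nonempty := by
    by_contra hne
    rw [Set.not_nonempty_iff_eq_empty] at hne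
    have := isGLB_Mfun (G := G) (P := P) p v w
    rw [hne, Set.image_empty, isGLB_empty_iff, isTop_iff_eq_top] at this
    exact h this
  have hfin : (G.walksFT p.length v w).Finite :=
    (List.finite_length_eq EG p.length).subset fun _ h => h.1
  obtain ⟨q, hq, hmin⟩ := Set.exists_min_image _ (fun q => payoffSum P q p) hfin hne
  refine ⟨q, hq.1, DirGraph.isPath_of_mem_walksFT hq, ?_⟩
  refine (isGLB_Mfun p v w).unique (IsLeast.isGLB ⟨⟨q, hq, rfl⟩, ?_⟩)
  rintro _ ⟨q', hq', rfl⟩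
  exact WithTop.coe_le_coe.2 (hmin q' hq')

/-- Whether an entry of `M(p)` is finite depends only on the length of `p`. -/
theorem Mfun_ne_top_of_length_eq [Finite EG] {p p' : List EH} (hp' : p' ≠ [])
    (hlen : p'.length = p.length) {v w : VG} (h : Mfun G P p v w ≠ ⊤) :
    Mfun G P p' v w ≠ ⊤ := by
  obtain ⟨q, hq, hpath, -⟩ := exists_eq_Mfun h
  exact ne_top_of_le_ne_top (WithTop.coe_ne_top) (Mfun_le hp' hpath (hq.trans hlen.symm))

theorem Mfun_append_le [Finite EG] {p p' : List EH} (hp : p ≠ []) (v z w : VG) :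
    Mfun G P (p ++ p') v w ≤ Mfun G P p v z + Mfun G P p' z w := by
  by_cases h : Mfun G P p v z = ⊤
  · simp [h]
  by_cases h' : Mfun G P p' z w = ⊤
  · simp [h']
  obtain ⟨q, hq, hpath, he⟩ := exists_eq_Mfun h
  obtain ⟨q', hq', hpath', he'⟩ := exists_eq_Mfun h'
  rw [he, he', ← WithTop.coe_add, ← payoffSum_append hq]
  exact Mfun_le (by simp [hp]) (DirGraph.isPath_append.2 ⟨z, hpath, hpath'⟩) (by simp [hq, hq'])

theorem exists_Mfun_append_eq [Finite EG] [Nonempty VG] {p p' : List EH} (hp : p ≠ [])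
    (hp' : p' ≠ []) (v w : VG) :
    ∃ z, Mfun G P (p ++ p') v w = Mfun G P p v z + Mfun G P p' z w := by
  by_cases h : Mfun G P (p ++ p') v w = ⊤
  · obtain ⟨z⟩ := ‹Nonempty VG›
    exact ⟨z, by rw [h]; exact (top_le_iff.1 (h ▸ Mfun_append_le hp v z w)).symm⟩
  obtain ⟨r, hr, hpath, he⟩ := exists_eq_Mfun h
  rw [List.length_append] at hr
  obtain ⟨q, q', rfl, hq⟩ : ∃ q q', r = q ++ q' ∧ q.length = p.length :=
    ⟨r.take p.length, r.drop p.length, by simp, by simp; omega⟩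
  rw [List.length_append] at hr
  obtain ⟨z, hz, hz'⟩ := DirGraph.isPath_append.1 hpath
  refine ⟨z, (Mfun_append_le hp v z w).antisymm ?_⟩
  rw [he, payoffSum_append hq, WithTop.coe_add]
  exact add_le_add (Mfun_le hp hz hq) (Mfun_le hp' hz' (by omega))

theorem Mfun_append_shift [Finite EG] [Nonempty VG] {p p' r : List EH} (hp : p ≠ [])
    (hp' : p' ≠ []) (hr : r ≠ []) {d : WithTop ℤ}
    (h : ∀ v w, Mfun G P p' v w = Mfun G P p v w + d) (v w : VG) :
    Mfun G P (p' ++ r) v w = Mfun G P (p ++ r) v w + d := by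
  apply le_antisymm
  · obtain ⟨z, hz⟩ := exists_Mfun_append_eq (G := G) (P := P) hp hr v w
    rw [hz, add_right_comm, ← h]
    exact Mfun_append_le hp' v z w
  · obtain ⟨z, hz⟩ := exists_Mfun_append_eq (G := G) (P := P) hp' hr v w
    rw [hz, h, add_right_comm]
    exact add_le_add_left (Mfun_append_le hp v z w) d

theorem exists_abs_payoff_le [Finite EG] [Finite EH] (P : EG → EH → ℤ) :
    ∃ B : ℤ, 0 ≤ B ∧ ∀ e f, |P e f| ≤ B := by
  obtain ⟨B, hB⟩ := (Set.finite_range fun x : EG × EH => |P x.1 x.2|).bddAbove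
  exact ⟨max B 0, le_max_right _ _, fun e f => le_max_of_le_left (hB ⟨(e, f), rfl⟩)⟩

/-- The finite entries of `M(p)` differ by a bounded amount, uniformly in `p`. -/
theorem exists_Mfun_le_add [Finite VG] [Finite EG] [Finite EH] (hG : G.Primitive)
    (P : EG → EH → ℤ) :
    ∃ C : ℤ, 0 ≤ C ∧ ∀ p : List EH, p ≠ [] → ∀ (v w v' w' : VG) (a a' : ℤ),
      Mfun G P p v w = a → Mfun G P p v' w' = a' → a ≤ a' + C := by
  obtain ⟨K, hK⟩ := hG.exists_agreeOffEnds
  obtain ⟨B, hB₀, hB⟩ := exists_abs_payoff_le P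
  refine ⟨4 * (K * B), by positivity, fun p hp v w v' w' a a' ha ha' => ?_⟩
  obtain ⟨q₀, hq₀, hpath₀, -⟩ := exists_eq_Mfun (ha ▸ WithTop.coe_ne_top)
  obtain ⟨q, hq, hpath, he⟩ := exists_eq_Mfun (ha' ▸ WithTop.coe_ne_top)
  obtain ⟨q', hpath', hag⟩ := hK v w v' w' q q₀ hpath hpath₀ (hq₀.trans hq.symm)
  have h1 := Mfun_le (P := P) hp hpath' (hag.length_eq.trans hq)
  have h2 := hag.payoffSum_le hB₀ hB p hq.symm
  rw [ha', WithTop.coe_inj] at he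
  rw [ha, WithTop.coe_le_coe] at h1
  omega

end Payoff

section Sofic

variable {VG EG VH EH : Type} {G : DirGraph VG EG} {H : DirGraph VH EH} {P : EG → EH → ℤ}

theorem ne_nil_of_mem_walksDagger {p : List EH} (hp : p ∈ walksDagger G H P) : p ≠ [] := by
  obtain ⟨u, v, h, -⟩ := hp
  exact DirGraph.ne_nil_of_mem_walksFT h

theorem mem_walksDagger_iff {p : List EH} (hp : p ≠ []) :
    p ∈ walksDagger G H P ↔ ∃ u v, H.IsPath u v p ∧ ∀ p' : List EH, p'.length = p.length →
      H.IsPath u v p' → ¬ StrictDom (Mfun G P p) (Mfun G P p') := by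
  refine exists_congr fun u => exists_congr fun v => ?_
  rw [DirGraph.mem_walksFT hp]
  constructor
  · rintro ⟨⟨-, h⟩, -, h'⟩
    refine ⟨h, fun p' hlen hp' hdom => h' ⟨_, ⟨p', ?_, rfl⟩, hdom⟩⟩
    have : p' ≠ [] := List.ne_nil_of_length_pos (hlen ▸ List.length_pos_iff.2 hp)
    exact (DirGraph.mem_walksFT this).2 ⟨hlen, hp'⟩
  · rintro ⟨h, h'⟩
    refine ⟨⟨rfl, h⟩, ⟨p, (DirGraph.mem_walksFT hp).2 ⟨rfl, h⟩, rfl⟩, ?_⟩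
    rintro ⟨_, ⟨p', hp', rfl⟩, hdom⟩
    exact h' p' hp'.1 (DirGraph.isPath_of_mem_walksFT hp') hdom

/-- Up to a bounded amount, no walk does better than a non-improvable walk of the same length,
whatever its endpoints. -/
theorem exists_Mfun_le_walksDagger [Finite VG] [Finite EG] [Finite VH] [Finite EH]
    (hG : G.Primitive) (hH : H.Primitive) (P : EG → EH → ℤ) :
    ∃ C : ℤ, 0 ≤ C ∧ ∀ p ∈ walksDagger G H P, ∀ (p' : List EH) (x y : VH), H.IsPath x y p' →
      p'.length = p.length → ∀ (v w v' w' : VG) (a a' : ℤ),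
      Mfun G P p' v w = a → Mfun G P p v' w' = a' → a ≤ a' + C := by
  obtain ⟨C, hC₀, hC⟩ := exists_Mfun_le_add hG P
  obtain ⟨N, hN⟩ := hG.exists_bound
  obtain ⟨K, hK⟩ := hH.exists_agreeOffEnds
  obtain ⟨B, hB₀, hB⟩ := exists_abs_payoff_le P
  refine ⟨2 * C + 4 * (K * B) + 2 * (N * B), by positivity,
    fun p hp p' x y hpath' hlen v w v' w' a a' ha ha' => ?_⟩
  have hKB : 0 ≤ 4 * (K * B) := by positivity
  have hNB : 0 ≤ 2 * (N * B) := by positivity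
  have hpne := ne_nil_of_mem_walksDagger hp
  have hpne' : p' ≠ [] := List.ne_nil_of_length_pos (hlen ▸ List.length_pos_iff.2 hpne)
  rcases lt_or_ge p.length N with hshort | hlong
  · obtain ⟨q, hq, -, he⟩ := exists_eq_Mfun (ha ▸ WithTop.coe_ne_top)
    obtain ⟨q', hq', -, he'⟩ := exists_eq_Mfun (ha' ▸ WithTop.coe_ne_top)
    rw [ha, WithTop.coe_inj] at he
    rw [ha', WithTop.coe_inj] at he'
    have h1 := abs_le.1 (abs_payoffSum_le hB q p' hq)
    have h2 := abs_le.1 (abs_payoffSum_le hB q' p hq')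
    have h3 : (p.length : ℤ) * B ≤ N * B :=
      mul_le_mul_of_nonneg_right (by exact_mod_cast hshort.le) hB₀
    rw [hlen] at h1
    linarith [h1.2, h2.1]
  · obtain ⟨s, t, hst, hmax⟩ := (mem_walksDagger_iff hpne).1 hp
    obtain ⟨r, hr, hag⟩ := hK s t x y p' p hpath' hst hlen.symm
    have hrlen := hag.length_eq
    have hnd := hmax r (hrlen.trans hlen) hr
    simp only [StrictDom, not_forall, not_lt] at hnd
    obtain ⟨b, c, hbc⟩ := hnd
    obtain ⟨q₀, hq₀, hpath₀⟩ := hN _ hlong b c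
    obtain ⟨k, hk⟩ := WithTop.ne_top_iff_exists.1
      (ne_top_of_le_ne_top WithTop.coe_ne_top (Mfun_le (P := P) hpne hpath₀ hq₀))
    obtain ⟨q, hq, hpath, he⟩ := exists_eq_Mfun (ne_top_of_le_ne_top (hk ▸ WithTop.coe_ne_top) hbc)
    have h1 := Mfun_le (P := P) hpne' hpath (hq.trans hrlen)
    obtain ⟨l, hl⟩ := WithTop.ne_top_iff_exists.1 (ne_top_of_le_ne_top WithTop.coe_ne_top h1)
    have h2 := hC p' hpne' v w b c a l ha hl.symm
    have h3 := hC p hpne b c v' w' k a' hk.symm ha'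
    have h4 := hag.symm.payoffSum_le hB₀ (P := fun f e => P e f) (fun f e => hB e f) q hq
    rw [payoffSum_flip P q p', payoffSum_flip P q r] at h4
    rw [← hl, WithTop.coe_le_coe] at h1
    rw [← hk, he, WithTop.coe_le_coe] at hbc
    linarith

open Classical in
/-- Some finite entry of `M(p)` (or `0` if there is none). -/
noncomputable def baseValue (G : DirGraph VG EG) (P : EG → EH → ℤ) (p : List EH) : ℤ :=
  if h : ∃ c : ℤ, ∃ v w, Mfun G P p v w = c then h.choose else 0

theorem exists_eq_baseValue {p : List EH} {v w : VG} (h : Mfun G P p v w ≠ ⊤) :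
    ∃ v' w', Mfun G P p v' w' = baseValue G P p := by
  obtain ⟨c, hc⟩ := WithTop.ne_top_iff_exists.1 h
  have h : ∃ c : ℤ, ∃ v w, Mfun G P p v w = c := ⟨c, v, w, hc.symm⟩
  rw [baseValue, dif_pos h]
  exact h.choose_spec

/-- `M(p)` translated by the constant `-c`. -/
noncomputable def shiftedMfun (G : DirGraph VG EG) (P : EG → EH → ℤ) (c : ℤ) (p : List EH) :
    VG → VG → WithTop ℤ :=
  fun v w => Mfun G P p v w + ((-c : ℤ) : WithTop ℤ)

theorem Mfun_eq_add_of_shiftedMfun_eq {p p' : List EH} {c c' : ℤ}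
    (h : shiftedMfun G P c p = shiftedMfun G P c' p') (v w : VG) :
    Mfun G P p v w = Mfun G P p' v w + ((c - c' : ℤ) : WithTop ℤ) := by
  have h' := congrFun (congrFun h v) w
  simp only [shiftedMfun] at h'
  calc Mfun G P p v w = Mfun G P p v w + ((-c : ℤ) : WithTop ℤ) + ((c : ℤ) : WithTop ℤ) := by
        rw [add_assoc, ← WithTop.coe_add]; simp
    _ = _ := by rw [h', add_assoc, ← WithTop.coe_add]; congr 2; ring

/-- The information about a prefix `p` that decides which extensions are non-improvable: its
normalized matrix, its endpoints, and the competing walks that are not worse by more than `K`. -/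
noncomputable def walkState (G : DirGraph VG EG) (H : DirGraph VH EH) (P : EG → EH → ℤ) (K : ℤ)
    (p : List EH) :
    (VG → VG → WithTop ℤ) × Set (VH × VH) × Set (VH × VH × (VG → VG → WithTop ℤ)) :=
  (shiftedMfun G P (baseValue G P p) p, {x | H.IsPath x.1 x.2 p},
    {x | (∃ p' : List EH, p'.length = p.length ∧ H.IsPath x.1 x.2.1 p' ∧
      shiftedMfun G P (baseValue G P p) p' = x.2.2) ∧ ∀ v w, ((-K : ℤ) : WithTop ℤ) ≤ x.2.2 v w})

theorem exists_walkState [Finite VG] [Finite EG] [Finite VH] [Finite EH]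
    (hG : G.Primitive) (hH : H.Primitive) (P : EG → EH → ℤ) :
    ∃ K : ℤ, (walkState G H P K '' walksDagger G H P).Finite ∧
      ∀ s ∈ walksDagger G H P, ∀ s' ∈ walksDagger G H P, ∀ t ∈ walksDagger G H P,
        walkState G H P K s = walkState G H P K s' → s ++ t ∈ walksDagger G H P →
          s' ++ t ∈ walksDagger G H P := by
  have := hG.nonempty
  obtain ⟨C, hC₀, hC⟩ := exists_Mfun_le_add hG P
  obtain ⟨C', hC'₀, hC'⟩ := exists_Mfun_le_walksDagger hG hH P
  obtain ⟨K, hK⟩ : ∃ K, K = C' + 2 * C := ⟨_, rfl⟩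
  have hlow : ∀ s ∈ walksDagger G H P, ∀ t ∈ walksDagger G H P, ∀ (a b : List EH) (x y z : VH),
      a.length = s.length → b.length = t.length → H.IsPath x y a → H.IsPath y z b →
      StrictDom (Mfun G P (s ++ t)) (Mfun G P (a ++ b)) →
      ∀ v w, ((-K : ℤ) : WithTop ℤ) ≤ shiftedMfun G P (baseValue G P s) a v w := by
    intro s hs t ht a b x y z ha hb hxa hyb hdom v w
    have hs₀ := ne_nil_of_mem_walksDagger hs
    have ht₀ := ne_nil_of_mem_walksDagger ht
    have ha₀ : a ≠ [] := List.ne_nil_of_length_pos (ha ▸ List.length_pos_iff.2 hs₀)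
    have hb₀ : b ≠ [] := List.ne_nil_of_length_pos (hb ▸ List.length_pos_iff.2 ht₀)
    obtain ⟨z, hz⟩ := exists_Mfun_append_eq (G := G) (P := P) hs₀ ht₀ v w
    have hlt := hdom v w
    obtain ⟨k, hk⟩ := WithTop.ne_top_iff_exists.1 hlt.ne_top
    rw [hz] at hk
    obtain ⟨i, j, hi, hj, hij⟩ := WithTop.add_eq_coe.1 hk.symm
    obtain ⟨i', hi'⟩ := WithTop.ne_top_iff_exists.1
      (Mfun_ne_top_of_length_eq ha₀ ha (hi ▸ WithTop.coe_ne_top))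
    obtain ⟨j', hj'⟩ := WithTop.ne_top_iff_exists.1
      (Mfun_ne_top_of_length_eq hb₀ hb (hj ▸ WithTop.coe_ne_top))
    have h1 := hlt.trans_le (Mfun_append_le ha₀ v z w)
    rw [hz, ← hi, ← hj, ← hi', ← hj', ← WithTop.coe_add, ← WithTop.coe_add,
      WithTop.coe_lt_coe] at h1
    have h2 := hC' t ht b y _ hyb hb z w z w j' j hj'.symm hj.symm
    obtain ⟨v₁, w₁, h₁⟩ := exists_eq_baseValue (G := G) (P := P) (p := s)
      (v := v) (w := z) (hi ▸ WithTop.coe_ne_top)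
    have h3 := hC s hs₀ v₁ w₁ v z _ i h₁ hi.symm
    by_cases h : Mfun G P a v w = ⊤
    · simp [shiftedMfun, h]
    obtain ⟨l, hl⟩ := WithTop.ne_top_iff_exists.1 h
    have h4 := hC a ha₀ v z v w i' l hi'.symm hl.symm
    rw [shiftedMfun, ← hl, ← WithTop.coe_add, WithTop.coe_le_coe]
    linarith
  refine ⟨K, ?_, ?_⟩
  · set T : Set (WithTop ℤ) := insert ⊤ ((↑) '' Set.Icc (-K) K) with hT
    have hTfin : T.Finite := ((Set.finite_Icc _ _).image _).insert _
    set D : Set (VG → VG → WithTop ℤ) := {f | ∀ v w, f v w ∈ T} with hD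
    have hDfin : D.Finite := Set.Finite.pi' fun _ => Set.Finite.pi' fun _ => hTfin
    have hmem : ∀ s ∈ walksDagger G H P, ∀ (a : List EH) (x y : VH), a.length = s.length →
        H.IsPath x y a →
        (∀ v w, ((-K : ℤ) : WithTop ℤ) ≤ shiftedMfun G P (baseValue G P s) a v w) →
        shiftedMfun G P (baseValue G P s) a ∈ D := by
      intro s hs a x y ha hxy hle v w
      have hs₀ := ne_nil_of_mem_walksDagger hs
      by_cases h : Mfun G P a v w = ⊤
      · exact .inl (by simp [shiftedMfun, h])
      obtain ⟨v₁, w₁, h₁⟩ := exists_eq_baseValue (G := G) (P := P) (p := s)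
        (Mfun_ne_top_of_length_eq hs₀ ha.symm h)
      obtain ⟨l, hl⟩ := WithTop.ne_top_iff_exists.1 h
      have h2 := hC' s hs a x y hxy ha v w v₁ w₁ l _ hl.symm h₁
      have h3 := hle v w
      rw [shiftedMfun, ← hl, ← WithTop.coe_add] at h3 ⊢
      rw [WithTop.coe_le_coe] at h3
      exact .inr ⟨_, ⟨h3, by linarith⟩, rfl⟩
    refine (hDfin.prod ((Set.toFinite (Set.univ : Set (Set (VH × VH)))).prod
      (((Set.finite_univ (α := VH)).prod
        ((Set.finite_univ (α := VH)).prod hDfin)).finite_subsets))).subset ?_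
    rintro _ ⟨s, hs, rfl⟩
    have hs₀ := ne_nil_of_mem_walksDagger hs
    refine ⟨?_, Set.mem_univ _, ?_⟩
    · obtain ⟨u, v, huv, -⟩ := (mem_walksDagger_iff hs₀).1 hs
      refine hmem s hs s u v rfl huv fun v w => ?_
      by_cases h : Mfun G P s v w = ⊤
      · simp [shiftedMfun, h]
      obtain ⟨v₁, w₁, h₁⟩ := exists_eq_baseValue h
      obtain ⟨l, hl⟩ := WithTop.ne_top_iff_exists.1 h
      have h2 := hC s hs₀ v₁ w₁ v w _ l h₁ hl.symm
      rw [shiftedMfun, ← hl, ← WithTop.coe_add, WithTop.coe_le_coe]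
      linarith
    · rintro ⟨x, y, f⟩ ⟨⟨a, ha, hxy, rfl⟩, hle⟩
      exact ⟨Set.mem_univ _, Set.mem_univ _, hmem s hs a x y ha hxy hle⟩
  · intro s hs s' hs' t ht hstate hst
    have hs₀ := ne_nil_of_mem_walksDagger hs
    have hs'₀ := ne_nil_of_mem_walksDagger hs'
    have ht₀ := ne_nil_of_mem_walksDagger ht
    simp only [walkState, Prod.mk.injEq] at hstate
    obtain ⟨e₁, e₂, e₃⟩ := hstate
    obtain ⟨u, v, huv, hmax⟩ := (mem_walksDagger_iff (by simp [hs₀])).1 hst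
    obtain ⟨z, huz, hzv⟩ := DirGraph.isPath_append.1 huv
    have huz' : H.IsPath u z s' := (Set.ext_iff.1 e₂ (u, z)).1 huz
    refine (mem_walksDagger_iff (by simp [hs'₀])).2
      ⟨u, v, DirGraph.isPath_append.2 ⟨z, huz', hzv⟩, fun r hr hruv hdom => ?_⟩
    rw [List.length_append] at hr
    obtain ⟨a, b, rfl, ha⟩ : ∃ a b, r = a ++ b ∧ a.length = s'.length :=
      ⟨r.take s'.length, r.drop s'.length, by simp, by simp; omega⟩
    rw [List.length_append] at hr
    have hb : b.length = t.length := by omega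
    obtain ⟨y, huy, hyv⟩ := DirGraph.isPath_append.1 hruv
    have hmem := (Set.ext_iff.1 e₃ (u, y, shiftedMfun G P (baseValue G P s') a)).2
      ⟨⟨a, ha, huy, rfl⟩, hlow s' hs' t ht a b u y v ha hb huy hyv hdom⟩
    obtain ⟨⟨a', ha', huy', e₄⟩, -⟩ := hmem
    have ha₀ : a ≠ [] := List.ne_nil_of_length_pos (ha ▸ List.length_pos_iff.2 hs'₀)
    have ha'₀ : a' ≠ [] := List.ne_nil_of_length_pos (ha' ▸ List.length_pos_iff.2 hs₀)
    have hb₀ : b ≠ [] := List.ne_nil_of_length_pos (hb ▸ List.length_pos_iff.2 ht₀)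
    refine hmax (a' ++ b) (by simp [ha', hb]) (DirGraph.isPath_append.2 ⟨y, huy', hyv⟩)
      fun i j => ?_
    rw [Mfun_append_shift hs'₀ hs₀ ht₀ (Mfun_eq_add_of_shiftedMfun_eq e₁),
      Mfun_append_shift ha₀ ha'₀ hb₀ (Mfun_eq_add_of_shiftedMfun_eq e₄)]
    exact WithTop.add_lt_add_right WithTop.coe_ne_top (hdom i j)

theorem XHdag_eq : XHdag G H P = {x | ∀ m n : ℤ, m ≤ n → seg x m n ∈ walksDagger G H P} := by
  ext x
  refine ⟨fun h => h.2, fun h => ⟨fun n => ?_, h⟩⟩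
  obtain ⟨u, v, huv, -⟩ := h n (n + 1) (by omega)
  exact edge_of_seg huv.2.1

theorem XHdag_isSofic [Finite VG] [Finite EG] [Finite VH] [Finite EH]
    (hG : G.Primitive) (hH : H.Primitive) (P : EG → EH → ℤ) : IsSofic (XHdag G H P) := by
  obtain ⟨K, hfin, htrans⟩ := exists_walkState hG hH P
  rw [XHdag_eq]
  exact isSofic_of_finite_state _ _ hfin htrans

/-- Pairs of a non-improvable walk in `H` and an optimal response to it. -/
noncomputable def optimalPairs (G : DirGraph VG EG) (H : DirGraph VH EH) (P : EG → EH → ℤ) :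
    Set (List (EH × EG)) :=
  {z | z.map Prod.fst ∈ walksDagger G H P ∧ z.map Prod.snd ∈ Rset G P (z.map Prod.fst)}

theorem map_seg {A B : Type} (f : A → B) (x : ℤ → A) (m n : ℤ) :
    (seg x m n).map f = seg (fun i => f (x i)) m n := by
  simp [seg, List.map_ofFn, Function.comp_def]

theorem YdagSeq_eq :
    YdagSeq G H P = {z | ∀ m n : ℤ, m ≤ n → seg z m n ∈ optimalPairs G H P} := by
  ext z
  simp only [YdagSeq, XHdag_eq, optimalPairs, Set.mem_ofPred_eq, map_seg]
  refine ⟨fun h m n hmn => ⟨h.1 m n hmn, h.2.2 m n hmn⟩,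
    fun h => ⟨fun m n hmn => (h m n hmn).1, fun n => ?_, fun m n hmn => (h m n hmn).2⟩⟩
  obtain ⟨u, v, huv, -⟩ := (h n (n + 1) (by omega)).2
  exact edge_of_seg huv.2.1

theorem YdagSeq_isSofic [Finite VG] [Finite EG] [Finite VH] [Finite EH]
    (hG : G.Primitive) (hH : H.Primitive) (P : EG → EH → ℤ) : IsSofic (YdagSeq G H P) := by
  have := hG.nonempty
  obtain ⟨K, hfin, htrans⟩ := exists_walkState hG hH P
  rw [YdagSeq_eq]
  refine isSofic_of_finite_state _
    (fun z => (walkState G H P K (z.map Prod.fst),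
      {x : VG × VG | G.IsPath x.1 x.2 (z.map Prod.snd)})) ?_ ?_
  · refine (hfin.prod (Set.toFinite (Set.univ : Set (Set (VG × VG))))).subset ?_
    rintro _ ⟨z, hz, rfl⟩
    exact ⟨⟨_, hz.1, rfl⟩, Set.mem_univ _⟩
  · rintro s ⟨hs, v₁, w₁, hsR, hsM⟩ s' ⟨hs', v₂, w₂, hsR', hsM'⟩ t ⟨ht, htR⟩ hstate ⟨hst, hstR⟩
    simp only [Prod.mk.injEq] at hstate
    obtain ⟨e, e'⟩ := hstate
    simp only [List.map_append] at hst hstR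
    refine ⟨by simpa using htrans _ hs _ hs' _ ht e hst, ?_⟩
    simp only [List.map_append]
    have hs₀ := ne_nil_of_mem_walksDagger hs
    have hs'₀ := ne_nil_of_mem_walksDagger hs'
    have ht₀ := ne_nil_of_mem_walksDagger ht
    obtain ⟨v, w, hvw, hM⟩ := hstR
    obtain ⟨z, hvz, hzw⟩ := DirGraph.isPath_append.1 (DirGraph.isPath_of_mem_walksFT hvw)
    have hvz' : G.IsPath v z (s'.map Prod.snd) := (Set.ext_iff.1 e' (v, z)).1 hvz
    have hq₀ := DirGraph.ne_nil_of_mem_walksFT hsR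
    have hq₀' := DirGraph.ne_nil_of_mem_walksFT hsR'
    obtain ⟨rfl, rfl⟩ := (DirGraph.isPath_of_mem_walksFT hsR).source_target_eq hq₀ hvz
    obtain ⟨rfl, rfl⟩ := (DirGraph.isPath_of_mem_walksFT hsR').source_target_eq hq₀' hvz'
    have hshift := Mfun_eq_add_of_shiftedMfun_eq (congrArg Prod.fst e).symm
    refine ⟨v₂, w, (DirGraph.mem_walksFT (by simp [hq₀'])).2
      ⟨by simp, DirGraph.isPath_append.2 ⟨_, hvz', hzw⟩⟩, ?_⟩
    rw [Mfun_append_shift hs₀ hs'₀ ht₀ hshift, ← hM, payoffSum_append (by simp),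
      payoffSum_append (by simp), WithTop.coe_add, WithTop.coe_add, hsM', hshift, hsM,
      add_right_comm]

end Sofic

/-- `X_H†` and `Y†_{(H,G)}` are sofic shifts. -/
theorem XHdag_Ydag_sofic {VG EG VH EH : Type} [Fintype VG] [Fintype EG]
    [Fintype VH] [Fintype EH] (G : DirGraph VG EG) (H : DirGraph VH EH)
    (hG : G.Primitive) (hH : H.Primitive) (P : EG → EH → ℤ) :
    IsSofic (XHdag G H P) ∧ IsSofic (YdagSeq G H P) := by
  exact ⟨XHdag_isSofic hG hH P, YdagSeq_isSofic hG hH P⟩
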